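/- Let f_1,…,f_m ∈ ℂ[x_1,…,x_n] be nonzero, pairwise coprime homogeneous polynomials of positive degree with m > n. Then the quotient ℂ[x,s]/I(A) is the Rees algebra of the likelihood module M(A); equivalently, the likelihood ideal equals the saturation of the pre-likelihood ideal by the nonzero elements of R: I(A) = {g ∈ ℂ[x_1,…,x_n,s_1,…,s_m] : there exists a nonzero p ∈ ℂ[x_1,…,x_n] with p·g ∈ I_0(A)}. -/

import Mathlib

open MvPolynomial

noncomputable section

/-- The polynomial ring `R = ℂ[x_1,…,x_n]`. -/
abbrev PolyR (n : ℕ) : Type := MvPolynomial (Fin n) ℂ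

/-- The polynomial ring `ℂ[x_1,…,x_n,s_i : i ∈ ι]`. -/
abbrev PolyRS (n : ℕ) (ι : Type) : Type := MvPolynomial (Fin n ⊕ ι) ℂ

variable {n : ℕ} {ι : Type} [Fintype ι]

/-- The `R`-linear map given by the matrix `Q`, sending `(a, b)` to the vector with
`i`-th entry `a_i f_i + Σ_j b_j ∂f_i/∂x_j`. -/
def Qmap (f : ι → PolyR n) :
    ((ι → PolyR n) × (Fin n → PolyR n)) →ₗ[PolyR n] (ι → PolyR n) where
  toFun ab := fun i => ab.1 i * f i + ∑ j, ab.2 j * pderiv j (f i)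
  map_add' x y := by
    funext i
    simp only [Prod.fst_add, Prod.snd_add, Pi.add_apply, add_mul, Finset.sum_add_distrib]
    ring
  map_smul' r x := by
    funext i
    simp only [Prod.smul_fst, Prod.smul_snd, Pi.smul_apply, smul_eq_mul, RingHom.id_apply,
      mul_assoc, ← Finset.mul_sum]
    ring

/-- The `R`-linear map given by the Jacobian matrix `Jac(F)`. -/
def jacMap (f : ι → PolyR n) : (Fin n → PolyR n) →ₗ[PolyR n] (ι → PolyR n) where
  toFun b := fun i => ∑ j, b j * pderiv j (f i)
  map_add' x y := by
    funext i
    simp only [Pi.add_apply, add_mul, Finset.sum_add_distrib]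
  map_smul' r x := by
    funext i
    simp only [Pi.smul_apply, smul_eq_mul, RingHom.id_apply, mul_assoc, ← Finset.mul_sum]

/-- The log-derivation module `logDer(A) ⊆ R^m`. -/
def logDer (f : ι → PolyR n) : Submodule (PolyR n) (ι → PolyR n) where
  carrier := {a | ∃ b : Fin n → PolyR n, ∀ i, a i * f i + ∑ j, b j * pderiv j (f i) = 0}
  zero_mem' := ⟨0, fun i => by simp⟩
  add_mem' := by
    rintro a a' ⟨b, hb⟩ ⟨b', hb'⟩
    refine ⟨b + b', fun i => ?_⟩
    have h1 := hb i
    have h2 := hb' i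
    simp only [Pi.add_apply, add_mul, Finset.sum_add_distrib]
    linear_combination h1 + h2
  smul_mem' := by
    rintro c a ⟨b, hb⟩
    refine ⟨c • b, fun i => ?_⟩
    have h1 := hb i
    simp only [Pi.smul_apply, smul_eq_mul, mul_assoc, ← Finset.mul_sum]
    linear_combination c * h1

/-- The pre-likelihood ideal `I₀(A) ⊆ ℂ[x,s]`, generated by the polynomials
`Σ_i a_i s_i` for `a ∈ logDer(A)`. -/
def preLikelihoodIdeal (f : ι → PolyR n) : Ideal (PolyRS n ι) :=
  Ideal.span {g | ∃ a ∈ logDer f, g = ∑ i, rename Sum.inl (a i) * X (Sum.inr i)}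

/-- The Jacobian matrix of `F = (f_1,…,f_m)` evaluated at a point `x ∈ ℂ^n`. -/
def jacAt (f : ι → PolyR n) (x : Fin n → ℂ) : Matrix ι (Fin n) ℂ :=
  Matrix.of fun i j => eval x (pderiv j (f i))

/-- The maximal rank of the Jacobian matrix over all points of `ℂ^n`. -/
def jacMaxRank (f : ι → PolyR n) : ℕ :=
  ⨆ x : Fin n → ℂ, (jacAt f x).rank

/-- The critical-point locus of the log-likelihood `ℓ_A = Σ_j s_j log f_j`,
with denominators cleared, together with the maximal-rank regularity condition. -/
def critLocus [DecidableEq ι] (f : ι → PolyR n) : Set ((Fin n → ℂ) × (ι → ℂ)) :=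
  {p | (∀ j, eval p.1 (f j) ≠ 0) ∧ (jacAt f p.1).rank = jacMaxRank f ∧
    ∀ i : Fin n, ∑ j, p.2 j * eval p.1 (pderiv i (f j)) *
      ∏ k ∈ Finset.univ.erase j, eval p.1 (f k) = 0}

/-- The likelihood ideal `I(A)`: all polynomials in `ℂ[x,s]` vanishing on the
critical-point locus. -/
def likelihoodIdeal [DecidableEq ι] (f : ι → PolyR n) : Ideal (PolyRS n ι) where
  carrier := {g | ∀ p ∈ critLocus f, eval (Sum.elim p.1 p.2) g = 0}
  zero_mem' := fun p _ => by simp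
  add_mem' := fun {a b} ha hb p hp => by simp [map_add, ha p hp, hb p hp]
  smul_mem' := fun c g hg p hp => by simp [smul_eq_mul, hg p hp]

/-- An arrangement is gentle if its pre-likelihood ideal equals its likelihood ideal. -/
def IsGentle [DecidableEq ι] (f : ι → PolyR n) : Prop :=
  preLikelihoodIdeal f = likelihoodIdeal f

/-- The module `Der(A)` of `A`-derivations: derivations `θ` with `θ(f) ∈ ⟨f⟩`,
where `f = f_1 ⋯ f_m`. -/
def DerA (f : ι → PolyR n) : Submodule (PolyR n) (Derivation ℂ (PolyR n) (PolyR n)) where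
  carrier := {θ | θ (∏ i, f i) ∈ Ideal.span {∏ i, f i}}
  zero_mem' := by simp
  add_mem' := by
    intro a b ha hb
    simpa using Ideal.add_mem _ ha hb
  smul_mem' := by
    intro c θ hθ
    simpa [smul_eq_mul] using Ideal.mul_mem_left _ c hθ


/-- Every matrix over a field has a generalized inverse. -/
theorem Matrix.exists_mul_mul_eq_self {K α β : Type*} [Field K] [Fintype α] [Fintype β]
    [DecidableEq α] [DecidableEq β] (A : Matrix α β K) :
    ∃ G : Matrix β α K, A * G * A = A := by
  obtain ⟨g, hg⟩ := A.toLin'.rangeRestrict.exists_rightInverse_of_surjective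
    (LinearMap.range_rangeRestrict _)
  obtain ⟨G, hG⟩ := g.exists_extend
  refine ⟨LinearMap.toMatrix' G, Matrix.toLin'.injective (LinearMap.ext fun v => ?_)⟩
  have h1 : G (A.toLin' v) = g (A.toLin'.rangeRestrict v) :=
    LinearMap.congr_fun hG (A.toLin'.rangeRestrict v)
  have h2 := congrArg Subtype.val (LinearMap.congr_fun hg (A.toLin'.rangeRestrict v))
  rw [Matrix.toLin'_mul, Matrix.toLin'_mul, Matrix.toLin'_toMatrix']
  simp only [LinearMap.comp_apply]
  rw [h1]
  exact h2

/-- If `G` is a generalized inverse of `A` and `B` is a matrix of rank at most that of `A` for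
which `1 + G (B - A)` is invertible, then `B` has the same rank as `A` and
the inverse of `1 + G (B - A)` maps `ker A` into `ker B`. -/
theorem Matrix.rank_eq_and_mul_adjugate_eq_zero {K α β : Type*} [Field K] [Fintype α] [Fintype β]
    [DecidableEq α] [DecidableEq β] {A B : Matrix α β K} {G : Matrix β α K}
    (hG : A * G * A = A) (hr : B.rank ≤ A.rank) (hdet : (1 + G * (B - A)).det ≠ 0) :
    B.rank = A.rank ∧ B * ((1 + G * (B - A)).adjugate * (1 - G * A)) = 0 := by
  set T := 1 + G * (B - A) with hT
  have hTinj : Function.Injective T.toLin' := by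
    intro v w h
    have h' := congrArg (fun u => T.adjugate.mulVec u) h
    simp only [Matrix.toLin'_apply, Matrix.mulVec_mulVec, Matrix.adjugate_mul,
      Matrix.smul_mulVec, Matrix.one_mulVec] at h'
    exact smul_right_injective _ hdet h'
  have hle : (LinearMap.ker B.toLin').map T.toLin' ≤ LinearMap.ker A.toLin' := by
    rintro _ ⟨v, hv, rfl⟩
    have hv' : B.mulVec v = 0 := by simpa using hv
    have : T.mulVec v = (1 - G * A).mulVec v := by
      simp only [hT, Matrix.mul_sub, Matrix.add_mulVec, Matrix.sub_mulVec, ← Matrix.mulVec_mulVec,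
        hv', Matrix.mulVec_zero]
      abel
    rw [LinearMap.mem_ker, Matrix.toLin'_apply, Matrix.toLin'_apply, this, Matrix.mulVec_mulVec,
      Matrix.mul_sub, ← Matrix.mul_assoc, hG, Matrix.mul_one, sub_self, Matrix.zero_mulVec]
  have hmap : Module.finrank K ((LinearMap.ker B.toLin').map T.toLin') =
      Module.finrank K (LinearMap.ker B.toLin') :=
    (Submodule.equivMapOfInjective _ hTinj _).finrank_eq.symm
  have hA := A.toLin'.finrank_range_add_finrank_ker
  have hB := B.toLin'.finrank_range_add_finrank_ker
  have hfle := Submodule.finrank_mono hle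
  have hrA : A.rank = Module.finrank K (LinearMap.range A.toLin') := rfl
  have hrB : B.rank = Module.finrank K (LinearMap.range B.toLin') := rfl
  refine ⟨by omega, ?_⟩
  have heq : (LinearMap.ker B.toLin').map T.toLin' = LinearMap.ker A.toLin' :=
    Submodule.eq_of_le_of_finrank_eq hle (by omega)
  refine Matrix.toLin'.injective (LinearMap.ext fun v => ?_)
  have hv : (1 - G * A).mulVec v ∈ LinearMap.ker A.toLin' := by
    rw [LinearMap.mem_ker, Matrix.toLin'_apply, Matrix.mulVec_mulVec,
      Matrix.mul_sub, ← Matrix.mul_assoc, hG, Matrix.mul_one, sub_self, Matrix.zero_mulVec]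
  rw [← heq] at hv
  obtain ⟨w, hw, hwv⟩ := hv
  have hw' : B.mulVec w = 0 := by simpa using hw
  rw [Matrix.toLin'_apply] at hwv
  rw [Matrix.toLin'_apply, ← Matrix.mulVec_mulVec, ← Matrix.mulVec_mulVec, ← hwv,
    Matrix.mulVec_mulVec (M := T.adjugate), Matrix.adjugate_mul, Matrix.smul_mulVec,
    Matrix.one_mulVec, Matrix.mulVec_smul, hw', smul_zero, map_zero, LinearMap.zero_apply]

/-- Substitutions that agree modulo an ideal give results that agree modulo that ideal. -/
theorem MvPolynomial.bind₁_sub_bind₁_mem {σ τ R : Type*} [CommRing R]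
    {I : Ideal (MvPolynomial τ R)} {φ ψ : σ → MvPolynomial τ R} (h : ∀ i, φ i - ψ i ∈ I)
    (q : MvPolynomial σ R) : bind₁ φ q - bind₁ ψ q ∈ I := by
  rw [← Ideal.Quotient.mk_eq_mk_iff_sub_mem]
  have : (Ideal.Quotient.mkₐ R I).comp (bind₁ φ) = (Ideal.Quotient.mkₐ R I).comp (bind₁ ψ) := by
    ext i
    simpa using (Ideal.Quotient.mk_eq_mk_iff_sub_mem _ _).2 (h i)
  exact DFunLike.congr_fun this q

theorem MvPolynomial.eval_sumElim_rename_inl {σ τ R : Type*} [CommSemiring R]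
    (x : σ → R) (s : τ → R) (p : MvPolynomial σ R) :
    eval (Sum.elim x s) (rename Sum.inl p) = eval x p := by
  rw [eval_rename, Sum.elim_comp_inl]

/-- After multiplication by a power of `D`, every polynomial in `(x, s)` becomes a
polynomial in `(x, D s)`. -/
theorem exists_bind₁_eq_pow_mul {κ : Type} (D : PolyR n) (g : PolyRS n κ) :
    ∃ (N : ℕ) (h : PolyRS n κ),
      bind₁ (Sum.elim (fun i => X (Sum.inl i)) fun j => rename Sum.inl D * X (Sum.inr j)) h =
        rename Sum.inl D ^ N * g := by
  have hD : bind₁ (Sum.elim (fun i => X (Sum.inl i)) fun j => rename Sum.inl D * X (Sum.inr j))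
      (rename Sum.inl D) = (rename Sum.inl D : PolyRS n κ) := by
    rw [bind₁_rename, Sum.elim_comp_inl]
    exact DFunLike.congr_fun (show bind₁ _ = rename Sum.inl by ext i; simp) D
  induction g using MvPolynomial.induction_on with
  | C a => exact ⟨0, C a, by simp⟩
  | add p q hp hq =>
    obtain ⟨N, h, hh⟩ := hp
    obtain ⟨N', h', hh'⟩ := hq
    refine ⟨N + N', rename Sum.inl D ^ N' * h + rename Sum.inl D ^ N * h', ?_⟩
    rw [map_add, map_mul, map_mul, map_pow, map_pow, hD, hh, hh']
    ring
  | mul_X p i hp =>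
    obtain ⟨N, h, hh⟩ := hp
    cases i with
    | inl i =>
      refine ⟨N, h * X (Sum.inl i), ?_⟩
      rw [map_mul, hh, bind₁_X_right, Sum.elim_inl]
      ring
    | inr j =>
      refine ⟨N + 1, h * X (Sum.inr j), ?_⟩
      rw [map_mul, hh, bind₁_X_right, Sum.elim_inr]
      ring

/-- The coefficient matrix of the likelihood equations with denominators cleared. -/
def likelihoodMatrix [DecidableEq ι] (f : ι → PolyR n) : Matrix (Fin n) ι (PolyR n) :=
  Matrix.of fun i j => pderiv i (f j) * ∏ k ∈ Finset.univ.erase j, f k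

theorem likelihoodMatrix_row_mem [DecidableEq ι] (f : ι → PolyR n) (i : Fin n) :
    ∑ j, rename Sum.inl (likelihoodMatrix f i j) * X (Sum.inr j) ∈ preLikelihoodIdeal f := by
  refine Ideal.subset_span ⟨likelihoodMatrix f i, ⟨Pi.single i (-∏ k, f k), fun j => ?_⟩, rfl⟩
  rw [Finset.sum_eq_single i (fun k _ hk => by simp [hk]) (by simp), Pi.single_eq_same,
    likelihoodMatrix, Matrix.of_apply, mul_assoc,
    Finset.prod_erase_mul _ _ (Finset.mem_univ j)]
  ring

theorem likelihoodMatrix_map_eval [DecidableEq ι] (f : ι → PolyR n) (x : Fin n → ℂ) :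
    (likelihoodMatrix f).map (eval x) =
      (jacAt f x).transpose *
        Matrix.diagonal fun j => ∏ k ∈ Finset.univ.erase j, eval x (f k) := by
  ext i j
  simp [likelihoodMatrix, jacAt, Matrix.mul_diagonal, map_prod]

theorem rank_likelihoodMatrix_map_eval [DecidableEq ι] {f : ι → PolyR n} {x : Fin n → ℂ}
    (hx : ∀ j, eval x (f j) ≠ 0) :
    ((likelihoodMatrix f).map (eval x)).rank = (jacAt f x).rank := by
  rw [likelihoodMatrix_map_eval, Matrix.rank_mul_eq_left_of_isUnit_det, Matrix.rank_transpose]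
  rw [Matrix.det_diagonal, isUnit_iff_ne_zero]
  exact Finset.prod_ne_zero_iff.2 fun j _ => Finset.prod_ne_zero_iff.2 fun k _ => hx k

theorem mem_critLocus_iff [DecidableEq ι] {f : ι → PolyR n} {x : Fin n → ℂ} {s : ι → ℂ} :
    (x, s) ∈ critLocus f ↔ (∀ j, eval x (f j) ≠ 0) ∧ (jacAt f x).rank = jacMaxRank f ∧
      ((likelihoodMatrix f).map (eval x)).mulVec s = 0 := by
  refine and_congr_right fun _ => and_congr_right fun _ => ?_
  rw [funext_iff]
  refine forall_congr' fun i => ?_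
  simp only [likelihoodMatrix, Matrix.mulVec, dotProduct, Matrix.map_apply, Matrix.of_apply,
    map_mul, map_prod, Pi.zero_apply]
  refine Eq.congr_left (Finset.sum_congr rfl fun j _ => ?_)
  ring

theorem bddAbove_range_rank_jacAt {κ : Type} (f : κ → PolyR n) :
    BddAbove (Set.range fun x : Fin n → ℂ => (jacAt f x).rank) :=
  ⟨n, by rintro _ ⟨x, rfl⟩; simpa using (jacAt f x).rank_le_card_width⟩

theorem rank_jacAt_le {κ : Type} (f : κ → PolyR n) (x : Fin n → ℂ) :
    (jacAt f x).rank ≤ jacMaxRank f :=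
  le_ciSup (bddAbove_range_rank_jacAt f) x

/-- A complex matrix, viewed as a matrix of constant polynomials. -/
def constMatrix {α β : Type*} (n : ℕ) (A : Matrix α β ℂ) : Matrix α β (PolyR n) :=
  A.map C

theorem constMatrix_map_eval {α β : Type*} (A : Matrix α β ℂ) (x : Fin n → ℂ) :
    (constMatrix n A).map (eval x) = A := by
  ext
  simp [constMatrix]

theorem map_eval_one_add_constMatrix_mul {α β : Type*} [Fintype α] [Fintype β] [DecidableEq β]
    (G : Matrix β α ℂ) (A : Matrix α β ℂ) (M : Matrix α β (PolyR n)) (x : Fin n → ℂ) :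
    (1 + constMatrix n G * (M - constMatrix n A)).map (eval x) = 1 + G * (M.map (eval x) - A) := by
  rw [Matrix.map_add _ (map_add _), Matrix.map_mul, Matrix.map_sub _ (map_sub _),
    constMatrix_map_eval, constMatrix_map_eval, Matrix.map_one _ (map_zero _) (map_one _)]

/-- The Jacobian matrix attains its maximal rank at some point off the arrangement. -/
theorem exists_rank_jacAt_eq {f : ι → PolyR n} (hne : ∀ i, f i ≠ 0) :
    ∃ x, (∀ j, eval x (f j) ≠ 0) ∧ (jacAt f x).rank = jacMaxRank f := by
  classical
  obtain ⟨y, hy⟩ : jacMaxRank f ∈ Set.range fun x : Fin n → ℂ => (jacAt f x).rank :=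
    Nat.sSup_mem (Set.range_nonempty _) (bddAbove_range_rank_jacAt f)
  obtain ⟨G, hG⟩ := (jacAt f y).exists_mul_mul_eq_self
  let J : Matrix ι (Fin n) (PolyR n) := Matrix.of fun i j => pderiv j (f i)
  have hJ (x : Fin n → ℂ) : J.map (eval x) = jacAt f x := rfl
  let D : PolyR n := (1 + constMatrix n G * (J - constMatrix n (jacAt f y))).det
  have hD (x : Fin n → ℂ) : eval x D = (1 + G * (jacAt f x - jacAt f y)).det := by
    rw [RingHom.map_det, RingHom.mapMatrix_apply, map_eval_one_add_constMatrix_mul, hJ]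
  have hD0 : D ≠ 0 := by
    intro h
    have := hD y
    simp [h] at this
  have hF : ∏ j, f j ≠ 0 := Finset.prod_ne_zero_iff.2 fun j _ => hne j
  have hprod : D * ∏ j, f j ≠ 0 :=
    mul_ne_zero hD0 hF
  obtain ⟨x, hx⟩ : ∃ x, eval x (D * ∏ j, f j) ≠ 0 := by
    by_contra! h
    exact hprod (MvPolynomial.funext fun x => by rw [h x, map_zero])
  rw [map_mul, map_prod] at hx
  refine ⟨x, fun j => Finset.prod_ne_zero_iff.1 (right_ne_zero_of_mul hx) j (Finset.mem_univ j), ?_⟩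
  rw [← hy]
  refine (Matrix.rank_eq_and_mul_adjugate_eq_zero hG ?_ ?_).1
  · exact (rank_jacAt_le f x).trans hy.ge
  · rw [← hD]
    exact left_ne_zero_of_mul hx

/-- Near a point off the arrangement where the Jacobian has maximal rank, the critical locus is
parametrized by polynomials `σ`, congruent to `D s` modulo the pre-likelihood ideal. -/
theorem exists_critLocus_parametrization [DecidableEq ι] {f : ι → PolyR n} {x₀ : Fin n → ℂ}
    (hx₀ : ∀ j, eval x₀ (f j) ≠ 0) (hr : (jacAt f x₀).rank = jacMaxRank f) :
    ∃ (D : PolyR n) (σ : ι → PolyRS n ι), eval x₀ D ≠ 0 ∧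
      (∀ j, rename Sum.inl D * X (Sum.inr j) - σ j ∈ preLikelihoodIdeal f) ∧
      ∀ x s, (∀ j, eval x (f j) ≠ 0) → eval x D ≠ 0 →
        (x, fun j => eval (Sum.elim x s) (σ j)) ∈ critLocus f := by
  set M := likelihoodMatrix f with hM
  set A := M.map (eval x₀) with hA
  obtain ⟨G, hG⟩ := A.exists_mul_mul_eq_self
  set T : Matrix ι ι (PolyR n) := 1 + constMatrix n G * (M - constMatrix n A) with hT
  set E : Matrix ι ι (PolyR n) := T.adjugate * (1 - constMatrix n G * constMatrix n A) with hE
  have hTx (x : Fin n → ℂ) : T.map (eval x) = 1 + G * (M.map (eval x) - A) :=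
    map_eval_one_add_constMatrix_mul G A M x
  have hDx (x : Fin n → ℂ) : eval x T.det = (1 + G * (M.map (eval x) - A)).det := by
    rw [RingHom.map_det, RingHom.mapMatrix_apply, hTx]
  have hEx (x : Fin n → ℂ) :
      E.map (eval x) = (1 + G * (M.map (eval x) - A)).adjugate * (1 - G * A) := by
    have h3 : T.adjugate.map (eval x) = (T.map (eval x)).adjugate :=
      RingHom.map_adjugate (eval x) T
    rw [hE, Matrix.map_mul, h3, hTx, Matrix.map_sub _ (map_sub _), Matrix.map_mul,
      constMatrix_map_eval, constMatrix_map_eval, Matrix.map_one _ (map_zero _) (map_one _)]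
  refine ⟨T.det, fun j => ∑ k, rename Sum.inl (E j k) * X (Sum.inr k), ?_, fun j => ?_,
    fun x s hx hD => ?_⟩
  · rw [hDx, ← hA]
    simp
  · have hmat : T.det • (1 : Matrix ι ι (PolyR n)) - E = T.adjugate * constMatrix n G * M := by
      rw [← Matrix.adjugate_mul, hE, ← Matrix.mul_sub, Matrix.mul_assoc]
      congr 1
      rw [hT, Matrix.mul_sub]
      abel
    have hrow : rename Sum.inl T.det * X (Sum.inr j) -
        ∑ k, rename Sum.inl (E j k) * X (Sum.inr k) =
        ∑ i, rename Sum.inl ((T.adjugate * constMatrix n G) j i) *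
          ∑ k, rename Sum.inl (M i k) * (X (Sum.inr k) : PolyRS n ι) := by
      calc _ = ∑ k, rename Sum.inl ((T.det • (1 : Matrix ι ι (PolyR n)) - E) j k) *
              (X (Sum.inr k) : PolyRS n ι) := by
            simp only [Matrix.sub_apply, Matrix.smul_apply, Matrix.one_apply, smul_eq_mul,
              map_sub, sub_mul, Finset.sum_sub_distrib]
            simp [apply_ite, ite_mul]
        _ = _ := by
            rw [hmat]
            simp only [Matrix.mul_apply (M := T.adjugate * constMatrix n G), map_sum, map_mul,
              Finset.sum_mul, Finset.mul_sum, mul_assoc]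
            exact Finset.sum_comm
    rw [hrow]
    exact Ideal.sum_mem _ fun i _ => Ideal.mul_mem_left _ _ (likelihoodMatrix_row_mem f i)
  · have hrA : A.rank = jacMaxRank f := by rw [hA, hM, rank_likelihoodMatrix_map_eval hx₀, hr]
    have hrM : (M.map (eval x)).rank = (jacAt f x).rank := rank_likelihoodMatrix_map_eval hx
    obtain ⟨h1, h2⟩ := Matrix.rank_eq_and_mul_adjugate_eq_zero hG
      (by rw [hrM, hrA]; exact rank_jacAt_le f x) (by rwa [← hDx])
    refine mem_critLocus_iff.2 ⟨hx, by rw [← hrM, h1, hrA], ?_⟩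
    have hσ : (fun j => eval (Sum.elim x s) (∑ k, rename Sum.inl (E j k) * X (Sum.inr k))) =
        (E.map (eval x)).mulVec s := by
      funext j
      simp [Matrix.mulVec, dotProduct, eval_sumElim_rename_inl]
    rw [hσ, Matrix.mulVec_mulVec, hEx, h2, Matrix.zero_mulVec]

theorem smul_mem_critLocus [DecidableEq ι] {f : ι → PolyR n} {x : Fin n → ℂ} {s : ι → ℂ}
    (h : (x, s) ∈ critLocus f) (c : ℂ) : (x, c • s) ∈ critLocus f := by
  rw [mem_critLocus_iff] at h ⊢
  exact ⟨h.1, h.2.1, by rw [Matrix.mulVec_smul, h.2.2, smul_zero]⟩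

theorem preLikelihoodIdeal_le_likelihoodIdeal [DecidableEq ι] (f : ι → PolyR n) :
    preLikelihoodIdeal f ≤ likelihoodIdeal f := by
  refine Ideal.span_le.2 ?_
  rintro _ ⟨a, ⟨b, hb⟩, rfl⟩ ⟨x, s⟩ ⟨hx, -, hs⟩
  simp only [map_sum, map_mul, eval_sumElim_rename_inl, eval_X, Sum.elim_inr]
  have hF : ∏ k, eval x (f k) ≠ 0 := Finset.prod_ne_zero_iff.2 fun k _ => hx k
  refine (mul_eq_zero.1 ?_).resolve_left hF
  have key (j : ι) : (∏ k, eval x (f k)) * (eval x (a j) * s j) =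
      -∑ i, eval x (b i) * (s j * eval x (pderiv i (f j)) *
        ∏ k ∈ Finset.univ.erase j, eval x (f k)) := by
    have h := congrArg (eval x) (hb j)
    simp only [map_add, map_mul, map_sum, map_zero] at h
    rw [← Finset.mul_prod_erase _ _ (Finset.mem_univ j)]
    have h' : ∑ i, eval x (b i) * (s j * eval x (pderiv i (f j)) *
        ∏ k ∈ Finset.univ.erase j, eval x (f k)) =
        (∑ i, eval x (b i) * eval x (pderiv i (f j))) *
          (s j * ∏ k ∈ Finset.univ.erase j, eval x (f k)) := by
      rw [Finset.sum_mul]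
      exact Finset.sum_congr rfl fun i _ => by ring
    rw [h']
    linear_combination (s j * ∏ k ∈ Finset.univ.erase j, eval x (f k)) * h
  rw [Finset.mul_sum, Finset.sum_congr rfl fun j _ => key j, Finset.sum_neg_distrib,
    Finset.sum_comm, neg_eq_zero]
  refine Finset.sum_eq_zero fun i _ => ?_
  rw [← Finset.mul_sum, hs i, mul_zero]

/-- A polynomial vanishing wherever a nonzero polynomial in `x` does not vanish is zero. -/
theorem eq_zero_of_eval_eq_zero_of_ne {κ : Type} {q : PolyR n} (hq : q ≠ 0) {g : PolyRS n κ}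
    (h : ∀ x s, eval x q ≠ 0 → eval (Sum.elim x s) g = 0) : g = 0 := by
  have hq' : (rename Sum.inl q : PolyRS n κ) ≠ 0 := fun h0 =>
    hq (rename_injective _ Sum.inl_injective (by rw [h0, map_zero]))
  refine (mul_eq_zero.1 (MvPolynomial.funext fun y => ?_)).resolve_left hq'
  rw [← Sum.elim_comp_inl_inr y, map_mul, eval_sumElim_rename_inl, map_zero, mul_eq_zero]
  exact or_iff_not_imp_left.2 (h _ _)

theorem eval_bind₁_sumElim {κ : Type} (x : Fin n → ℂ) (s : κ → ℂ) (σ : κ → PolyRS n κ) (g : PolyRS n κ) :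
    eval (Sum.elim x s) (bind₁ (Sum.elim (fun i => X (Sum.inl i)) σ) g) =
      eval (Sum.elim x fun j => eval (Sum.elim x s) (σ j)) g := by
  rw [← coe_aeval_eq_eval, ← coe_aeval_eq_eval]
  simp only [RingHom.coe_coe]
  rw [aeval_bind₁]
  congr 2
  funext i
  cases i <;> simp [aeval_eq_eval]

theorem exists_mul_mem_preLikelihoodIdeal [DecidableEq ι] {f : ι → PolyR n} (hne : ∀ i, f i ≠ 0)
    {g : PolyRS n ι} (hg : g ∈ likelihoodIdeal f) :
    ∃ p : PolyR n, p ≠ 0 ∧ rename Sum.inl p * g ∈ preLikelihoodIdeal f := by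
  obtain ⟨x₀, hx₀, hr⟩ := exists_rank_jacAt_eq hne
  obtain ⟨D, σ, hD, hσ, hcrit⟩ := exists_critLocus_parametrization hx₀ hr
  have hD0 : D ≠ 0 := by
    rintro rfl
    simp at hD
  obtain ⟨N, h, hh⟩ := exists_bind₁_eq_pow_mul D g
  refine ⟨D ^ N, pow_ne_zero N hD0, ?_⟩
  have hF : ∏ j, f j ≠ 0 := Finset.prod_ne_zero_iff.2 fun j _ => hne j
  have hzero : bind₁ (Sum.elim (fun i => X (Sum.inl i)) σ) h = 0 := by
    refine eq_zero_of_eval_eq_zero_of_ne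
      (mul_ne_zero hD0 hF) fun x s hxs => ?_
    rw [map_mul, map_prod] at hxs
    have hDx := left_ne_zero_of_mul hxs
    have hmem := smul_mem_critLocus (hcrit x s (fun j => Finset.prod_ne_zero_iff.1
      (right_ne_zero_of_mul hxs) j (Finset.mem_univ j)) hDx) (eval x D)⁻¹
    have h1 := congrArg (eval (Sum.elim x ((eval x D)⁻¹ • fun j => eval (Sum.elim x s) (σ j)))) hh
    rw [eval_bind₁_sumElim, map_mul, hg _ hmem, mul_zero] at h1
    rw [eval_bind₁_sumElim, ← h1]
    congr 2
    funext j
    simp [eval_sumElim_rename_inl, hDx]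
  have := bind₁_sub_bind₁_mem (I := preLikelihoodIdeal f)
    (φ := Sum.elim (fun i => X (Sum.inl i)) fun j => rename Sum.inl D * X (Sum.inr j))
    (ψ := Sum.elim (fun i => X (Sum.inl i)) σ) (fun i => by cases i <;> simp [hσ]) h
  rwa [hh, hzero, sub_zero, ← map_pow] at this

theorem mem_likelihoodIdeal_of_mul_mem [DecidableEq ι] {f : ι → PolyR n} (hne : ∀ i, f i ≠ 0)
    {g : PolyRS n ι} {p : PolyR n} (hp : p ≠ 0)
    (hg : rename Sum.inl p * g ∈ preLikelihoodIdeal f) : g ∈ likelihoodIdeal f := by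
  rintro ⟨x₀, s₀⟩ hmem
  obtain ⟨hx₀, hr, -⟩ := id hmem
  obtain ⟨D, σ, hD, hσ, hcrit⟩ := exists_critLocus_parametrization hx₀ hr
  have hD0 : D ≠ 0 := by
    rintro rfl
    simp at hD
  have hF : ∏ j, f j ≠ 0 := Finset.prod_ne_zero_iff.2 fun j _ => hne j
  have hzero : bind₁ (Sum.elim (fun i => X (Sum.inl i)) σ) g = 0 := by
    refine eq_zero_of_eval_eq_zero_of_ne (mul_ne_zero (mul_ne_zero hD0 hp)
      hF) fun x s hxs => ?_
    rw [map_mul, map_mul, map_prod] at hxs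
    have hDx := left_ne_zero_of_mul (left_ne_zero_of_mul hxs)
    have hpx := right_ne_zero_of_mul (left_ne_zero_of_mul hxs)
    have h1 := preLikelihoodIdeal_le_likelihoodIdeal f hg _ (hcrit x s (fun j =>
      Finset.prod_ne_zero_iff.1 (right_ne_zero_of_mul hxs) j (Finset.mem_univ j)) hDx)
    rw [map_mul, eval_sumElim_rename_inl] at h1
    rw [eval_bind₁_sumElim]
    exact (mul_eq_zero.1 h1).resolve_left hpx
  have h2 := congrArg (eval (Sum.elim x₀ ((eval x₀ D)⁻¹ • s₀))) hzero
  rw [eval_bind₁_sumElim, map_zero] at h2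
  have hs : (fun j => eval (Sum.elim x₀ ((eval x₀ D)⁻¹ • s₀)) (σ j)) = s₀ := by
    funext j
    have h3 := preLikelihoodIdeal_le_likelihoodIdeal f (hσ j) _
      (smul_mem_critLocus hmem (eval x₀ D)⁻¹)
    rw [map_sub, map_mul, eval_sumElim_rename_inl, eval_X, Sum.elim_inr] at h3
    dsimp only at h3
    rw [Pi.smul_apply,
      smul_eq_mul, mul_inv_cancel_left₀ hD, sub_eq_zero] at h3
    exact h3.symm
  rwa [hs] at h2

/-- The quotient `ℂ[x,s]/I(A)` is the Rees algebra of the likelihood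
module: equivalently, the likelihood ideal is the saturation of the pre-likelihood ideal
by the nonzero elements of `R`, i.e. `I(A) = {g : ∃ 0 ≠ p ∈ R, p·g ∈ I₀(A)}`. -/
theorem statement6 {n m : ℕ} (hmn : n < m) (f : Fin m → PolyR n) (d : Fin m → ℕ)
    (hne : ∀ i, f i ≠ 0)
    (hhom : ∀ i, (f i).IsHomogeneous (d i))
    (hd : ∀ i, 0 < d i)
    (hcop : ∀ i j, i ≠ j → IsRelPrime (f i) (f j)) :
    ∀ g : PolyRS n (Fin m),
      g ∈ likelihoodIdeal f ↔
        ∃ p : PolyR n, p ≠ 0 ∧ rename Sum.inl p * g ∈ preLikelihoodIdeal f := by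
  exact fun g => ⟨exists_mul_mem_preLikelihoodIdeal hne,
    fun ⟨_, hp, hg⟩ => mem_likelihoodIdeal_of_mul_mem hne hp hg⟩

end
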